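/- arXiv:1503.03246 — 2 statements merged into one kernel-verified Lean document; each statement's English description precedes it below -/
import Mathlib

section
/- Let X be the one-point compactification of ℤ and let T : X → X be the homeomorphism extending the map n ↦ n+1 on ℤ (and fixing the point at infinity). Then the topological entropy of T on X is zero, while the topological entropy of F_T on H(X,X) is infinite. -/
open Set Filter Topology

/-- `E` is an `(n, ε)`-separated set for the map `S`: any two distinct points of `E` are more
than `ε` apart in the dynamical metric `max_{0 ≤ j < n} dist (S^j x) (S^j y)`. -/
def IsDynSep {Z : Type*} [PseudoMetricSpace Z] (S : Z → Z) (n : ℕ) (ε : ℝ) (E : Set Z) : Prop :=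
  ∀ x ∈ E, ∀ y ∈ E, x ≠ y → ∃ j < n, ε < dist (S^[j] x) (S^[j] y)

/-- The maximal cardinality `sep(n, ε; K)` of an `(n, ε)`-separated subset of `K`. -/
noncomputable def sepNum {Z : Type*} [PseudoMetricSpace Z] (S : Z → Z) (n : ℕ) (ε : ℝ)
    (K : Set Z) : ℕ :=
  sSup {m : ℕ | ∃ E : Finset Z, ↑E ⊆ K ∧ IsDynSep S n ε ↑E ∧ E.card = m}

/-- The topological entropy of `S` on the set `K`:
`lim_{ε → 0} limsup_n (1/n) log sep(n, ε; K)`; the limit as `ε → 0` is realized as the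
supremum over `ε > 0`, the quantity being monotone in `ε`. -/
noncomputable def entropyOnSet {Z : Type*} [PseudoMetricSpace Z] (S : Z → Z) (K : Set Z) :
    EReal :=
  ⨆ (ε : ℝ) (_ : 0 < ε),
    Filter.atTop.limsup fun n : ℕ => ((Real.log (sepNum S n ε K) / n : ℝ) : EReal)

/-- The topological entropy of the restriction of `S` to a subset `A` of its domain:
the supremum of the entropies on all compact subsets of `A`. -/
noncomputable def entropyOn {Z : Type*} [PseudoMetricSpace Z] (S : Z → Z) (A : Set Z) : EReal :=
  ⨆ (K : Set Z) (_ : IsCompact K) (_ : K ⊆ A), entropyOnSet S K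

/-- The topological entropy of `S`: the supremum of the entropies on all compact sets. -/
noncomputable def dynEntropy {Z : Type*} [PseudoMetricSpace Z] (S : Z → Z) : EReal :=
  ⨆ (K : Set Z) (_ : IsCompact K), entropyOnSet S K

/-- The set `H(X,X)` of self-homeomorphisms of `X`, viewed inside `C(X,X)` (so that, for `X`
compact metric, it inherits the uniform metric `D(φ,ψ) = sup_x d(φ x, ψ x)`). -/
def HSet (X : Type*) [TopologicalSpace X] : Set C(X, X) := {f | IsHomeomorph f}

/-- The functional envelope map `F_T : φ ↦ T ∘ φ` on `C(X,X)`. -/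
def envMap {X : Type*} [TopologicalSpace X] (T : X ≃ₜ X) : C(X, X) → C(X, X) :=
  fun φ => (T : C(X, X)).comp φ

open OnePoint in
lemma mem_nhds_inf {V : Set (OnePoint ℤ)} (hV : V ∈ 𝓝 (∞ : OnePoint ℤ)) :
    ∃ M : ℕ, ∀ m : ℤ, (M : ℤ) ≤ |m| → (m : OnePoint ℤ) ∈ V := by
  obtain ⟨s, ⟨-, hs⟩, hsV⟩ := OnePoint.hasBasis_nhds_infty.mem_iff.1 hV
  have hfin : s.Finite := hs.finite_of_discrete
  obtain ⟨B, hB⟩ := (hfin.image (fun m : ℤ => m.natAbs)).bddAbove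
  refine ⟨B + 1, fun m hm => hsV (Or.inl ⟨m, fun hms => ?_, rfl⟩)⟩
  have := hB ⟨m, hms, rfl⟩
  simp only at this
  rw [Int.abs_eq_natAbs] at hm; omega

open OnePoint in
lemma nhds_inf_mem (M : ℕ) : {y : OnePoint ℤ | ∀ m : ℤ, y = m → (M : ℤ) ≤ |m|} ∈
    𝓝 (∞ : OnePoint ℤ) := by
  refine OnePoint.hasBasis_nhds_infty.mem_iff.2 ⟨Set.Icc (-M : ℤ) M,
    ⟨isClosed_discrete _, (Set.finite_Icc _ _).isCompact⟩, ?_⟩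
  rintro y (⟨m, hm, rfl⟩ | rfl) m' h
  · have : m = m' := by exact_mod_cast h
    subst this
    simp only [Set.mem_compl_iff, Set.mem_Icc] at hm
    rw [Int.abs_eq_natAbs]; omega
  · exact absurd h (OnePoint.infty_ne_coe _)

/-- Involution of `ℤ` swapping `-j` with `j * (k+1) + f j + 1` for each `j : ℕ`. -/
def sw (k : ℕ) (f : ℕ → Fin (k + 1)) (x : ℤ) : ℤ :=
  if x ≤ 0 then (-x) * (k + 1) + (f (-x).toNat : ℕ) + 1
  else if (((f ((x - 1) / (k + 1)).toNat : ℕ) : ℤ)) = (x - 1) % (k + 1)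
    then -((x - 1) / (k + 1)) else x

lemma sw_c (k : ℕ) (f : ℕ → Fin (k + 1)) (j : ℕ) (i : Fin (k + 1)) :
    sw k f ((j : ℤ) * (k + 1) + (i : ℕ) + 1) =
      if f j = i then -(j : ℤ) else (j : ℤ) * (k + 1) + (i : ℕ) + 1 := by
  have hi : ((i : ℕ) : ℤ) < k + 1 := by exact_mod_cast i.2
  have hd : ((j : ℤ) * (k + 1) + (i : ℕ) + 1 - 1) / (k + 1) = j := by
    rw [add_sub_cancel_right, mul_comm, Int.mul_add_ediv_left _ _ (by omega),
      Int.ediv_eq_zero_of_lt (by omega) hi, add_zero]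
  have hm : ((j : ℤ) * (k + 1) + (i : ℕ) + 1 - 1) % (k + 1) = (i : ℕ) := by
    rw [add_sub_cancel_right, mul_comm, Int.mul_add_emod_self_left,
      Int.emod_eq_of_lt (by omega) hi]
  have hpos : ¬ ((j : ℤ) * (k + 1) + (i : ℕ) + 1 ≤ 0) := not_le.2 (by positivity)
  unfold sw
  rw [if_neg hpos, hd, hm]
  simp [Fin.ext_iff]

lemma sw_neg (k : ℕ) (f : ℕ → Fin (k + 1)) (j : ℕ) :
    sw k f (-(j : ℤ)) = (j : ℤ) * (k + 1) + (f j : ℕ) + 1 := by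
  unfold sw
  rw [if_pos (by omega)]
  simp

lemma int_cases (k : ℕ) (x : ℤ) : (∃ j : ℕ, x = -(j : ℤ)) ∨
    ∃ (j : ℕ) (i : Fin (k + 1)), x = (j : ℤ) * (k + 1) + (i : ℕ) + 1 := by
  by_cases h : x ≤ 0
  · exact Or.inl ⟨(-x).toNat, by omega⟩
  · right
    obtain ⟨y, rfl⟩ : ∃ y : ℕ, x = y + 1 := ⟨(x - 1).toNat, by omega⟩
    refine ⟨y / (k + 1), ⟨y % (k + 1), Nat.mod_lt _ (by omega)⟩, ?_⟩
    have := Nat.div_add_mod' y (k + 1)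
    simp only [add_left_inj]
    exact_mod_cast this.symm

lemma sw_sw (k : ℕ) (f : ℕ → Fin (k + 1)) (x : ℤ) : sw k f (sw k f x) = x := by
  rcases int_cases k x with ⟨j, rfl⟩ | ⟨j, i, rfl⟩
  · rw [sw_neg, sw_c, if_pos rfl]
  · rw [sw_c]
    split_ifs with h
    · rw [sw_neg, h]
    · rw [sw_c, if_neg h]

lemma sw_bound (k : ℕ) (f : ℕ → Fin (k + 1)) (x : ℤ) :
    |sw k f x| ≤ |x| * (k + 1) + k + 1 := by
  rcases int_cases k x with ⟨j, rfl⟩ | ⟨j, i, rfl⟩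
  · rw [sw_neg, abs_of_nonneg (by positivity), abs_neg, abs_of_nonneg (by positivity)]
    have := (f j).2
    have : ((f j : ℕ) : ℤ) ≤ k := by omega
    linarith
  · rw [sw_c, abs_of_nonneg (a := (j : ℤ) * (k + 1) + (i : ℕ) + 1) (by positivity)]
    have h1 : (0 : ℤ) ≤ (j : ℤ) * k := by positivity
    have h0 : (0 : ℤ) ≤ (j : ℤ) := by positivity
    have h2 : (0 : ℤ) ≤ ((j : ℤ) * (k + 1) + (i : ℕ) + 1) * k := by positivity
    split_ifs
    · rw [abs_neg, abs_of_nonneg (by positivity)]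
      nlinarith
    · rw [abs_of_nonneg (by positivity)]
      nlinarith

lemma sw_cont (k : ℕ) (x : ℤ) : Continuous fun f : ℕ → Fin (k + 1) => sw k f x := by
  rcases int_cases k x with ⟨j, rfl⟩ | ⟨j, i, rfl⟩
  · simp only [sw_neg]
    exact (continuous_of_discreteTopology
      (f := fun a : Fin (k + 1) => (j : ℤ) * (k + 1) + (a : ℕ) + 1)).comp (continuous_apply j)
  · simp only [sw_c]
    exact (continuous_of_discreteTopology
      (f := fun a : Fin (k + 1) => if a = i then -(j : ℤ) else
        (j : ℤ) * (k + 1) + (i : ℕ) + 1)).comp (continuous_apply j)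

open OnePoint in
lemma psi_cont (k : ℕ) : Continuous
    fun p : (ℕ → Fin (k + 1)) × OnePoint ℤ => OnePoint.map (sw k p.1) p.2 := by
  rw [continuous_iff_continuousAt]
  rintro ⟨f, y⟩
  induction y using OnePoint.rec with
  | infty =>
    intro V hV
    simp only [OnePoint.map_infty] at hV
    obtain ⟨M, hM⟩ := mem_nhds_inf hV
    have hW := nhds_inf_mem (M * (k + 1) + k + 2)
    rw [nhds_prod_eq]
    rw [Filter.mem_map]
    refine Filter.mem_of_superset (Filter.prod_mem_prod Filter.univ_mem hW) ?_
    rintro ⟨g, z⟩ ⟨-, hz⟩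
    simp only [Set.mem_preimage]
    induction z using OnePoint.rec with
    | infty => exact mem_of_mem_nhds hV
    | coe m =>
      rw [OnePoint.map_some]
      apply hM
      have h1 := hz m rfl
      have h2 := sw_bound k g (sw k g m)
      rw [sw_sw] at h2
      push_cast at h1
      by_contra hlt
      push Not at hlt
      have : |sw k g m| * (k + 1) ≤ M * (k + 1) := by
        apply mul_le_mul_of_nonneg_right hlt.le; positivity
      linarith
  | coe m =>
    have h1 : 𝓝 ((f, (m : OnePoint ℤ))) = 𝓝 f ×ˢ pure (m : OnePoint ℤ) := by
      rw [nhds_prod_eq, OnePoint.nhds_coe_eq, nhds_discrete ℤ, Filter.map_pure]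
    unfold ContinuousAt
    rw [h1, Filter.prod_pure, Filter.tendsto_map'_iff]
    exact ((OnePoint.continuous_coe.comp (sw_cont k m)).tendsto f)

lemma sepBdd {Z : Type*} [PseudoMetricSpace Z] {S : Z → Z} (hS : Continuous S) (n : ℕ) {ε : ℝ}
    (hε : 0 < ε) {K : Set Z} (hK : IsCompact K) :
    BddAbove {m : ℕ | ∃ E : Finset Z, ↑E ⊆ K ∧ IsDynSep S n ε ↑E ∧ E.card = m} := by
  classical
  let U : Z → Set Z := fun x => {y | ∀ j ∈ Finset.range n, dist (S^[j] y) (S^[j] x) < ε / 2}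
  have hU : ∀ x ∈ K, U x ∈ 𝓝 x := by
    intro x _
    have : ∀ᶠ y in 𝓝 x, ∀ j ∈ Finset.range n, dist (S^[j] y) (S^[j] x) < ε / 2 := by
      rw [Filter.eventually_all_finset]
      intro j _
      exact ((hS.iterate j).tendsto x).eventually (Metric.ball_mem_nhds _ (half_pos hε))
    exact this
  obtain ⟨t, -, ht⟩ := hK.elim_nhds_subcover U hU
  refine ⟨t.card, ?_⟩
  rintro m ⟨E, hEK, hE, rfl⟩
  have hc : ∀ x ∈ E, ∃ c ∈ t, x ∈ U c := by
    intro x hx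
    simpa using ht (hEK hx)
  choose! c hc1 hc2 using hc
  refine Finset.card_le_card_of_injOn c hc1 ?_
  intro x hx y hy hxy
  by_contra hne
  obtain ⟨j, hj, hlt⟩ := hE x hx y hy hne
  have h1 := hc2 x hx j (Finset.mem_range.2 hj)
  have h2 := hc2 y hy j (Finset.mem_range.2 hj)
  rw [hxy] at h1
  have := dist_triangle_right (S^[j] x) (S^[j] y) (S^[j] (c y))
  linarith

open OnePoint in
lemma iter_coe {X : Type*} [MetricSpace X]
    (e : X ≃ₜ OnePoint ℤ) (T : X ≃ₜ X)
    (hT : ∀ (x : X) (n : ℤ), e x = (n : OnePoint ℤ) → e (T x) = ((n + 1 : ℤ) : OnePoint ℤ))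
    (x : X) (m : ℤ) (h : e x = (m : OnePoint ℤ)) (j : ℕ) :
    e (T^[j] x) = ((m + j : ℤ) : OnePoint ℤ) := by
  induction j with
  | zero => simpa using h
  | succ j ih =>
    rw [Function.iterate_succ_apply', hT _ _ ih]
    push_cast
    rw [add_assoc]

open OnePoint in
lemma iter_inf {X : Type*} [MetricSpace X]
    (e : X ≃ₜ OnePoint ℤ) (T : X ≃ₜ X)
    (hinf : ∀ x : X, e x = ∞ → e (T x) = ∞)
    (x : X) (h : e x = ∞) (j : ℕ) : e (T^[j] x) = ∞ := by
  induction j with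
  | zero => simpa using h
  | succ j ih => rw [Function.iterate_succ_apply', hinf _ ih]

open OnePoint in
lemma sep_T {X : Type*} [MetricSpace X] [CompactSpace X]
    (e : X ≃ₜ OnePoint ℤ) (T : X ≃ₜ X)
    (hT : ∀ (x : X) (n : ℤ), e x = (n : OnePoint ℤ) → e (T x) = ((n + 1 : ℤ) : OnePoint ℤ))
    (hinf : ∀ x : X, e x = ∞ → e (T x) = ∞) (K : Set X) {ε : ℝ} (hε : 0 < ε) :
    ∃ C : ℕ, ∀ n, sepNum T n ε K ≤ n + C := by
  classical
  have hV : e.symm ⁻¹' (Metric.ball (e.symm ∞) (ε / 2)) ∈ 𝓝 (∞ : OnePoint ℤ) :=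
    e.symm.continuous.continuousAt.preimage_mem_nhds (Metric.ball_mem_nhds _ (half_pos hε))
  obtain ⟨M, hM⟩ := mem_nhds_inf hV
  refine ⟨2 * M + 1, fun n => csSup_le' ?_⟩
  rintro _ ⟨E, -, hE, rfl⟩
  let R : Finset (OnePoint ℤ) :=
    insert ∞ ((Finset.Ico (-(M : ℤ) - n) M).image (fun m : ℤ => (m : OnePoint ℤ)))
  have hR : R.card ≤ n + (2 * M + 1) := by
    refine (Finset.card_insert_le _ _).trans ?_
    have := Finset.card_image_le (s := Finset.Ico (-(M : ℤ) - n) M)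
      (f := fun m : ℤ => (m : OnePoint ℤ))
    rw [Int.card_Ico] at this
    omega
  refine le_trans ?_ hR
  let c : X → OnePoint ℤ := fun x => if e x ∈ R then e x else ∞
  have hcR : ∀ x, c x ∈ R := by
    intro x
    by_cases h : e x ∈ R
    · simp only [c, if_pos h, h]
    · simp only [c, if_neg h]; exact Finset.mem_insert_self _ _
  have hcinf : ∀ x, c x = ∞ → ∀ j < n, dist (T^[j] x) (e.symm ∞) < ε / 2 := by
    intro x hx j hj
    rcases hy : e x with _ | m
    · have := iter_inf e T hinf x hy j
      rw [← this, e.symm_apply_apply, dist_self]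
      exact half_pos hε
    · have hy' : e x = (m : OnePoint ℤ) := hy
      by_cases h : e x ∈ R
      · simp only [c, if_pos h] at hx
        rw [hy'] at hx
        exact absurd hx (OnePoint.coe_ne_infty _)
      · have hm : ¬ (-(M : ℤ) - n ≤ m ∧ m < M) := by
          intro hm
          apply h
          rw [hy']
          exact Finset.mem_insert_of_mem (Finset.mem_image.2 ⟨m, Finset.mem_Ico.2 hm, rfl⟩)
        have := hM (m + j) (by
          by_cases h0 : 0 ≤ m + (j : ℤ)
          · rw [abs_of_nonneg h0]; omega
          · rw [abs_of_neg (by omega)]; omega)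
        rw [← iter_coe e T hT x m hy' j] at this
        simpa using this
  refine Finset.card_le_card_of_injOn c (fun x _ => hcR x) ?_
  intro x hx y hy hxy
  by_contra hne
  by_cases hci : c x = ∞
  · obtain ⟨j, hj, hlt⟩ := hE x hx y hy hne
    have h1 := hcinf x hci j hj
    have h2 := hcinf y (hxy ▸ hci) j hj
    have := dist_triangle_right (T^[j] x) (T^[j] y) (e.symm ∞)
    linarith
  · have key : ∀ z, c z ≠ ∞ → c z = e z := by
      intro z hz
      by_cases h : e z ∈ R
      · simp only [c, if_pos h]
      · simp only [c, if_neg h] at hz; exact absurd rfl hz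
    have hy' : c y ≠ ∞ := hxy ▸ hci
    rw [key x hci, key y hy'] at hxy
    exact hne (e.injective hxy)

lemma log_lim (C : ℕ) : Tendsto (fun n : ℕ => (((Real.log n + Real.log (C + 1)) / n : ℝ) : EReal))
    atTop (𝓝 0) := by
  have h1 : Tendsto (fun n : ℕ => Real.log (n : ℝ) / n) atTop (𝓝 0) :=
    (Real.isLittleO_log_id_atTop.tendsto_div_nhds_zero).comp tendsto_natCast_atTop_atTop
  have h2 : Tendsto (fun n : ℕ => Real.log ((C : ℝ) + 1) / n) atTop (𝓝 0) :=
    tendsto_const_div_atTop_nhds_zero_nat _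
  have h3 := h1.add h2
  simp only [← add_div, add_zero] at h3
  exact (continuous_coe_real_ereal.tendsto 0).comp h3

lemma envMap_iter {X : Type*} [TopologicalSpace X] (T : X ≃ₜ X) (j : ℕ) (φ : C(X, X)) (x : X) :
    ((envMap T)^[j] φ) x = T^[j] (φ x) := by
  induction j with
  | zero => rfl
  | succ j ih =>
    rw [Function.iterate_succ_apply', Function.iterate_succ_apply', ← ih]
    rfl

open OnePoint in
/-- The homeomorphisms of `X` coming from the swaps. -/
noncomputable def Phi {X : Type*} [TopologicalSpace X] (e : X ≃ₜ OnePoint ℤ) (k : ℕ) :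
    C(ℕ → Fin (k + 1), C(X, X)) :=
  ContinuousMap.curry ⟨fun p => e.symm (OnePoint.map (sw k p.1) (e p.2)),
    e.symm.continuous.comp ((psi_cont k).comp
      (continuous_fst.prodMk (e.continuous.comp continuous_snd)))⟩

open OnePoint in
lemma Phi_apply {X : Type*} [TopologicalSpace X] (e : X ≃ₜ OnePoint ℤ) (k : ℕ)
    (f : ℕ → Fin (k + 1)) (x : X) : Phi e k f x = e.symm (OnePoint.map (sw k f) (e x)) := rfl

lemma Phi_invol {X : Type*} [TopologicalSpace X] (e : X ≃ₜ OnePoint ℤ) (k : ℕ)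
    (f : ℕ → Fin (k + 1)) (x : X) : Phi e k f (Phi e k f x) = x := by
  rw [Phi_apply, Phi_apply, e.apply_symm_apply, e.symm_apply_eq]
  generalize e x = y
  induction y using OnePoint.rec with
  | infty => rfl
  | coe m => simp [sw_sw]

lemma Phi_mem {X : Type*} [TopologicalSpace X] (e : X ≃ₜ OnePoint ℤ) (k : ℕ)
    (f : ℕ → Fin (k + 1)) : Phi e k f ∈ HSet X := by
  let h : X ≃ₜ X :=
    { toFun := Phi e k f
      invFun := Phi e k f
      left_inv := Phi_invol e k f
      right_inv := Phi_invol e k f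
      continuous_toFun := (Phi e k f).continuous
      continuous_invFun := (Phi e k f).continuous }
  exact h.isHomeomorph

open OnePoint in
lemma sep_env {X : Type*} [MetricSpace X] [CompactSpace X]
    (e : X ≃ₜ OnePoint ℤ) (T : X ≃ₜ X)
    (hT : ∀ (x : X) (n : ℤ), e x = (n : OnePoint ℤ) → e (T x) = ((n + 1 : ℤ) : OnePoint ℤ))
    (k : ℕ) : ∃ ε > 0, ∀ n, (k + 1) ^ n ≤ sepNum (envMap T) n ε (Set.range (Phi e k)) := by
  classical
  have hopen : IsOpen ({e.symm ((0 : ℤ) : OnePoint ℤ)} : Set X) := by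
    have h0 : IsOpen ({((0 : ℤ) : OnePoint ℤ)} : Set (OnePoint ℤ)) := by
      have := OnePoint.isOpen_image_coe.2 (isOpen_discrete ({0} : Set ℤ))
      simpa using this
    have := h0.preimage e.continuous
    convert this using 1
    ext x
    simp [e.eq_symm_apply]
  obtain ⟨δ, hδ, hball⟩ := Metric.isOpen_iff.1 hopen _ rfl
  refine ⟨δ / 2, half_pos hδ, fun n => ?_⟩
  have hsep : ∀ f g : ℕ → Fin (k + 1), ∀ j < n, f j ≠ g j →
      δ / 2 < dist ((envMap T)^[j] (Phi e k f)) ((envMap T)^[j] (Phi e k g)) := by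
    intro f g j hj hfg
    let x : X := e.symm (((j : ℤ) * (k + 1) + (f j : ℕ) + 1 : ℤ) : OnePoint ℤ)
    refine lt_of_lt_of_le ?_ (ContinuousMap.dist_apply_le_dist x)
    rw [envMap_iter, envMap_iter]
    have h1 : T^[j] (Phi e k f x) = e.symm ((0 : ℤ) : OnePoint ℤ) := by
      rw [e.eq_symm_apply, iter_coe e T hT _ (-(j : ℤ)), neg_add_cancel]
      rw [Phi_apply, e.apply_symm_apply, e.apply_symm_apply, OnePoint.map_some, sw_c, if_pos rfl]
    have h2 : T^[j] (Phi e k g x) ≠ e.symm ((0 : ℤ) : OnePoint ℤ) := by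
      rw [Ne, e.eq_symm_apply,
        iter_coe e T hT _ ((j : ℤ) * (k + 1) + (f j : ℕ) + 1)]
      · rw [OnePoint.coe_eq_coe]
        positivity
      · rw [Phi_apply, e.apply_symm_apply, e.apply_symm_apply, OnePoint.map_some, sw_c,
          if_neg (Ne.symm hfg)]
    rw [h1, dist_comm]
    by_contra hle
    exact h2 (hball (Metric.mem_ball.2 (by linarith)))
  refine le_csSup (sepBdd (ContinuousMap.continuous_postcomp _) n (half_pos hδ)
    (isCompact_range (Phi e k).continuous)) ?_
  let ext : (Fin n → Fin (k + 1)) → (ℕ → Fin (k + 1)) :=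
    fun a j => if h : j < n then a ⟨j, h⟩ else 0
  have hext : ∀ a b : Fin n → Fin (k + 1), a ≠ b → ∃ j < n, δ / 2 <
      dist ((envMap T)^[j] (Phi e k (ext a))) ((envMap T)^[j] (Phi e k (ext b))) := by
    intro a b hab
    obtain ⟨i, hi⟩ := Function.ne_iff.1 hab
    refine ⟨i, i.2, hsep _ _ _ i.2 ?_⟩
    simpa [ext] using hi
  have hinj : Function.Injective fun a => Phi e k (ext a) := by
    intro a b hab
    by_contra hne
    obtain ⟨j, -, hj⟩ := hext a b hne
    simp only at hab
    rw [hab, dist_self] at hj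
    linarith
  refine ⟨Finset.univ.image fun a => Phi e k (ext a), ?_, ?_, ?_⟩
  · intro φ hφ
    obtain ⟨a, -, rfl⟩ := Finset.mem_image.1 (Finset.mem_coe.1 hφ)
    exact ⟨_, rfl⟩
  · intro φ hφ ψ hψ hne
    obtain ⟨a, -, rfl⟩ := Finset.mem_image.1 (Finset.mem_coe.1 hφ)
    obtain ⟨b, -, rfl⟩ := Finset.mem_image.1 (Finset.mem_coe.1 hψ)
    exact hext a b (fun h => hne (by rw [h]))
  · rw [Finset.card_image_of_injective _ hinj]
    simp

open OnePoint in
/-- For the "+1" homeomorphism `T` on the one-point compactification of `ℤ` (a compact metric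
space), the topological entropy of `T` is zero, while the entropy of the functional envelope
`(H(X,X), F_T)` is infinite. -/
theorem one_point_compactification_example {X : Type*} [MetricSpace X] [CompactSpace X]
    (e : X ≃ₜ OnePoint ℤ) (T : X ≃ₜ X)
    (hT : ∀ (x : X) (n : ℤ), e x = (n : OnePoint ℤ) → e (T x) = ((n + 1 : ℤ) : OnePoint ℤ))
    (hinf : ∀ x : X, e x = ∞ → e (T x) = ∞) :
    dynEntropy (⇑T) = 0 ∧ entropyOn (envMap T) (HSet X) = ⊤ := by
  constructor
  · apply le_antisymm
    · refine iSup₂_le fun K _ => iSup₂_le fun ε hε => ?_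
      obtain ⟨C, hC⟩ := sep_T e T hT hinf K hε
      rw [← (log_lim C).limsup_eq]
      refine limsup_le_limsup ?_
      filter_upwards [eventually_ge_atTop 1] with n hn
      have hn' : (1 : ℝ) ≤ n := by exact_mod_cast hn
      rw [EReal.coe_le_coe_iff]
      refine div_le_div_of_nonneg_right ?_ (by positivity)
      rcases Nat.eq_zero_or_pos (sepNum T n ε K) with h0 | h0
      · rw [h0, Nat.cast_zero, Real.log_zero]
        exact add_nonneg (Real.log_nonneg hn') (Real.log_nonneg (by simp))
      · rw [← Real.log_mul (by positivity) (by positivity)]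
        refine Real.log_le_log (by exact_mod_cast h0) ?_
        have : (sepNum T n ε K : ℝ) ≤ n + C := by exact_mod_cast hC n
        have hC0 : (0 : ℝ) ≤ C := by positivity
        nlinarith
    · refine le_trans ?_ (le_iSup₂_of_le (∅ : Set X) isCompact_empty
        (le_iSup₂_of_le (1 : ℝ) one_pos le_rfl))
      refine le_limsup_of_frequently_le' (Eventually.frequently (Eventually.of_forall fun n => ?_))
      rw [← EReal.coe_zero, EReal.coe_le_coe_iff]
      exact div_nonneg (Real.log_natCast_nonneg _) (by positivity)
  · rw [EReal.eq_top_iff_forall_lt]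
    intro y
    obtain ⟨k, hk⟩ := exists_nat_gt (Real.exp y)
    obtain ⟨ε, hε, hs⟩ := sep_env e T hT k
    have hlt : y < Real.log (k + 1) := by
      rw [Real.lt_log_iff_exp_lt (by positivity)]
      linarith
    refine lt_of_lt_of_le (EReal.coe_lt_coe_iff.2 hlt) ?_
    refine le_trans ?_ (le_iSup₂_of_le (Set.range (Phi e k))
      (isCompact_range (Phi e k).continuous)
      (le_iSup_of_le (by rintro _ ⟨f, rfl⟩; exact Phi_mem e k f)
        (le_iSup₂_of_le ε hε le_rfl)))
    refine le_limsup_of_frequently_le' (Eventually.frequently ?_)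
    filter_upwards [eventually_ge_atTop 1] with n hn
    have hn' : (0 : ℝ) < n := by exact_mod_cast hn
    rw [EReal.coe_le_coe_iff, le_div_iff₀ hn', mul_comm, ← Real.log_pow]
    refine Real.log_le_log (by positivity) ?_
    exact_mod_cast hs n
end

section
/- There exists a non-degenerate continuum X admitting a minimal homeomorphism such that every continuous surjection φ : X → X is either a minimal homeomorphism or has a fixed point. -/
open Set Filter Topology

/-- A self-map of a topological space is minimal if every forward orbit is dense. -/
def IsMinimal {X : Type*} [TopologicalSpace X] (T : X → X) : Prop :=
  ∀ x : X, Dense (Set.range fun n : ℕ => T^[n] x)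

namespace Slovak

set_option linter.unusedSectionVars false

section abstractPart

variable {Y : Type} [AddCommGroup Y] [TopologicalSpace Y]

/-- The properties of the base flow `ι` and of the function `f` used in the construction. -/
structure Good (ι : ℝ →+ Y) (f : Y → ℝ) : Prop where
  cont : Continuous ι
  inj : Function.Injective ι
  lift : ∀ γ : C(unitInterval, Y), ∃ θ : C(unitInterval, ℝ), ∀ s, γ s = γ 0 + ι (θ s)
  dense : ∀ D : ℤ, D ≠ 0 → DenseRange (fun n : ℕ => n • ι (D : ℝ))
  off : ∃ y, ∀ t, y ≠ ι t
  fcont : ∀ y, y ≠ 0 → ContinuousAt f y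
  frange : ∀ y, f y ∈ Icc (0 : ℝ) 1
  fleft : Tendsto (fun t => f (ι t)) (𝓝[<] 0) (𝓝 0)
  fosc : ∀ ε > 0, ∀ v ∈ Icc (0 : ℝ) 1, ∃ t ∈ Ioo (0 : ℝ) ε, f (ι t) = v

/-- The space: points of the orbit of `0` are blown up to arcs. -/
def XS (ι : ℝ →+ Y) (f : Y → ℝ) : Set (Y × (ℤ → ℝ)) :=
  {p | ∀ n : ℤ, p.2 n ∈ Icc (0 : ℝ) 1 ∧ (p.1 = ι n ∨ p.2 n = f (p.1 - ι n))}

variable {ι : ℝ →+ Y} {f : Y → ℝ}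

theorem isClosed_XS [IsTopologicalAddGroup Y] [T2Space Y] (h : Good ι f) : IsClosed (XS ι f) := by
  have : XS ι f = ⋂ n : ℤ, ({p | p.2 n ∈ Icc (0 : ℝ) 1} ∩ {p | p.1 = ι n ∨ p.2 n = f (p.1 - ι n)}) := by
    ext p; simp [XS]
  rw [this]
  refine isClosed_iInter fun n => IsClosed.inter ?_ ?_
  · exact isClosed_Icc.preimage (by fun_prop)
  · rw [← isOpen_compl_iff, isOpen_iff_mem_nhds]
    rintro p hp
    simp only [mem_compl_iff, mem_ofPred_eq, not_or] at hp
    have h1 : ∀ᶠ q : Y × (ℤ → ℝ) in 𝓝 p, q.1 ≠ ι n :=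
      continuousAt_fst.eventually_ne hp.1
    have h2 : ContinuousAt (fun q : Y × (ℤ → ℝ) => q.2 n - f (q.1 - ι n)) p := by
      refine ContinuousAt.sub (by fun_prop) ?_
      refine ContinuousAt.comp (f := fun q : Y × (ℤ → ℝ) => q.1 - ι n) (h.fcont _ (sub_ne_zero.2 hp.1)) (by fun_prop)
    have h3 := h2.eventually_ne (sub_ne_zero.2 hp.2)
    filter_upwards [h1, h3] with q a b
    simp only [mem_compl_iff, mem_ofPred_eq, not_or]
    exact ⟨a, sub_ne_zero.1 b⟩

theorem isCompact_XS [IsTopologicalAddGroup Y] [T2Space Y] [CompactSpace Y] (h : Good ι f) :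
    IsCompact (XS ι f) := by
  have hc : IsCompact ((univ : Set Y) ×ˢ (Set.pi univ fun _ : ℤ => Icc (0 : ℝ) 1)) :=
    isCompact_univ.prod (isCompact_univ_pi fun _ => isCompact_Icc)
  refine hc.of_isClosed_subset (isClosed_XS h) ?_
  intro p hp
  exact ⟨trivial, fun n _ => (hp n).1⟩

/-- The shift by `k`. -/
def S (ι : ℝ →+ Y) (f : Y → ℝ) (k : ℤ) (x : XS ι f) : XS ι f :=
  ⟨(x.1.1 + ι k, fun n => x.1.2 (n - k)), by
    intro n
    obtain ⟨h1, h2⟩ := x.2 (n - k)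
    refine ⟨h1, ?_⟩
    push_cast at h2
    rw [map_sub] at h2
    rcases h2 with h2 | h2
    · left; simp [h2]
    · right; simp only [h2]; congr 1; abel⟩

theorem S_add (k l : ℤ) (x : XS ι f) : S ι f k (S ι f l x) = S ι f (k + l) x := by
  apply Subtype.ext
  apply Prod.ext
  · simp [S]; abel
  · funext n; simp only [S]; ring_nf

theorem S_zero (x : XS ι f) : S ι f 0 x = x := by
  apply Subtype.ext
  apply Prod.ext
  · simp [S]
  · funext n; simp [S]

theorem S_fst (k : ℤ) (x : XS ι f) : (S ι f k x).1.1 = x.1.1 + ι k := rfl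

theorem S_iter (k : ℤ) (n : ℕ) (x : XS ι f) : (S ι f k)^[n] x = S ι f (n * k) x := by
  induction n generalizing x with
  | zero => simp [S_zero]
  | succ n ih => rw [Function.iterate_succ_apply, ih, S_add]; congr 1; push_cast; ring

theorem S_cont [IsTopologicalAddGroup Y] (k : ℤ) : Continuous (S ι f k) := by
  unfold S
  fun_prop

/-- The shift as a homeomorphism. -/
def SH [IsTopologicalAddGroup Y] (ι : ℝ →+ Y) (f : Y → ℝ) (k : ℤ) : XS ι f ≃ₜ XS ι f where
  toFun := S ι f k
  invFun := S ι f (-k)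
  left_inv x := by rw [S_add]; simp [S_zero]
  right_inv x := by rw [S_add]; simp [S_zero]
  continuous_toFun := S_cont k
  continuous_invFun := S_cont (-k)

/-- The graph map. -/
def G (h : Good ι f) (y : Y) : XS ι f :=
  ⟨(y, fun n => f (y - ι n)), fun _ => ⟨h.frange _, Or.inr rfl⟩⟩

theorem G_fst (h : Good ι f) (y : Y) : (G h y).1.1 = y := rfl

theorem eq_G (h : Good ι f) (x : XS ι f) (hx : ∀ n : ℤ, x.1.1 ≠ ι n) : x = G h x.1.1 := by
  apply Subtype.ext
  apply Prod.ext
  · rfl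
  · funext n
    exact (x.2 n).2.resolve_left (hx n)

theorem G_contAt [IsTopologicalAddGroup Y] (h : Good ι f) (y : Y) (hy : ∀ n : ℤ, y ≠ ι n) :
    ContinuousAt (G h) y := by
  refine tendsto_subtype_rng.2 ?_
  refine Tendsto.prodMk_nhds tendsto_id ?_
  rw [tendsto_pi_nhds]
  intro m
  exact (h.fcont _ (sub_ne_zero.2 (hy m))).tendsto.comp (tendsto_id.sub_const _)

theorem off_of_Ioo (h : Good ι f) (n : ℤ) {t : ℝ} (ht : t ∈ Ioo (n : ℝ) (n + 1)) (m : ℤ) :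
    ι t ≠ ι m := by
  intro e
  have := h.inj e
  subst this
  have h1 := ht.1
  have h2 := ht.2
  norm_cast at h1 h2
  omega

theorem lim [IsTopologicalAddGroup Y] (h : Good ι f) (n : ℤ) (x : XS ι f) (hx : x.1.1 = ι n) :
    x ∈ closure (G h '' (ι '' Ioo (n : ℝ) (n + 1))) := by
  have key : ∀ j : ℕ, ∃ t ∈ Ioo (0 : ℝ) (1 / ((j : ℝ) + 1)), f (ι t) = x.1.2 n := fun j =>
    h.fosc _ (by positivity) _ (x.2 n).1
  choose t ht hft using key
  have ht0 : Tendsto t atTop (𝓝 0) := by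
    refine tendsto_of_tendsto_of_tendsto_of_le_of_le tendsto_const_nhds
      tendsto_one_div_add_atTop_nhds_zero_nat (fun j => (ht j).1.le) (fun j => (ht j).2.le)
  have hι : Tendsto (fun j => ι (n + t j)) atTop (𝓝 (ι n)) := by
    have : Tendsto (fun j => (n : ℝ) + t j) atTop (𝓝 n) := by simpa using ht0.const_add (n : ℝ)
    exact (h.cont.tendsto _).comp this
  refine mem_closure_of_tendsto (f := fun j => G h (ι (n + t j))) (b := atTop) ?_ ?_
  · rw [tendsto_subtype_rng]
    have hx' : (x : Y × (ℤ → ℝ)) = (x.1.1, x.1.2) := rfl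
    rw [hx', hx]
    refine Tendsto.prodMk_nhds hι ?_
    rw [tendsto_pi_nhds]
    intro m
    by_cases hm : m = n
    · subst hm
      refine tendsto_const_nhds.congr fun j => ?_
      rw [← map_sub, add_sub_cancel_left, hft]
    · have hne : ι n ≠ ι m := fun e => hm (by exact_mod_cast (h.inj e).symm)
      have e : x.1.2 m = f (ι n - ι m) := by
        rw [← hx]; rw [← hx] at hne; exact (x.2 m).2.resolve_left hne
      rw [e]
      exact (h.fcont _ (sub_ne_zero.2 hne)).tendsto.comp (hι.sub_const _)
  · refine Eventually.of_forall fun j => ⟨_, ⟨_, ?_, rfl⟩, rfl⟩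
    have h1 := (ht j).1
    have h2 := (ht j).2
    have h3 : 1 / ((j : ℝ) + 1) ≤ 1 := by
      rw [div_le_one (by positivity)]; linarith [(Nat.cast_nonneg j : (0 : ℝ) ≤ j)]
    constructor <;> linarith

theorem dense_G [IsTopologicalAddGroup Y] (h : Good ι f) : Dense (G h '' {y | ∀ n : ℤ, y ≠ ι n}) := by
  intro x
  by_cases hx : ∀ n : ℤ, x.1.1 ≠ ι n
  · exact subset_closure ⟨_, hx, (eq_G h x hx).symm⟩
  · push Not at hx
    obtain ⟨n, hn⟩ := hx
    refine closure_mono (image_mono ?_) (lim h n x hn)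
    rintro _ ⟨t, ht, rfl⟩ m
    exact off_of_Ioo h n ht m

theorem minimal_S [IsTopologicalAddGroup Y] [T2Space Y] [CompactSpace Y] (h : Good ι f) (k : ℤ)
    (hk : k ≠ 0) : IsMinimal (S ι f k) := by
  intro x
  have : CompactSpace (XS ι f) := isCompact_iff_compactSpace.1 (isCompact_XS h)
  set C := closure (range fun n : ℕ => (S ι f k)^[n] x) with hC
  have hcl : IsClosed ((fun z : XS ι f => z.1.1) '' C) :=
    (isClosed_closure.isCompact.image (by fun_prop)).isClosed
  have hd : Dense ((fun z : XS ι f => z.1.1) '' C) := by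
    have h1 : DenseRange (fun n : ℕ => x.1.1 + n • ι (k : ℝ)) :=
      (Homeomorph.addLeft x.1.1).surjective.denseRange.comp (h.dense k hk) (by fun_prop)
    refine Dense.mono ?_ h1
    rintro _ ⟨n, rfl⟩
    refine ⟨_, subset_closure ⟨n, rfl⟩, ?_⟩
    simp only [S_iter, S_fst]
    push_cast
    rw [← nsmul_eq_mul, map_nsmul]
  have huniv : (fun z : XS ι f => z.1.1) '' C = univ := by
    rw [← hcl.closure_eq]; exact hd.closure_eq
  have hsub : G h '' {y | ∀ n : ℤ, y ≠ ι n} ⊆ C := by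
    rintro _ ⟨y, hy, rfl⟩
    have : y ∈ (fun z : XS ι f => z.1.1) '' C := huniv ▸ mem_univ y
    obtain ⟨z, hz, rfl⟩ := this
    rwa [← eq_G h z hy]
  intro z
  exact closure_minimal hsub isClosed_closure (dense_G h z)

/-- Paths cannot cross an oscillating arc from left to right. -/
theorem cross (h : Good ι f) (γ : C(unitInterval, XS ι f)) (τ : C(unitInterval, ℝ))
    (hτ : ∀ s, (γ s).1.1 = ι (τ s)) (n : ℤ) (h0 : τ 0 ≤ n) : τ 1 ≤ n := by
  by_contra! h1
  set K : Set unitInterval := {s | τ s ≤ n} with hK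
  have hKc : IsClosed K := isClosed_le (by fun_prop) (by fun_prop)
  obtain ⟨s0, hs0, hmax⟩ := hKc.isCompact.exists_isGreatest ⟨0, h0⟩
  have hgt : ∀ s, s0 < s → (n : ℝ) < τ s := by
    intro s hs
    by_contra! hc
    exact absurd (hmax hc) (not_le.2 hs)
  have hs01 : s0 < 1 := by
    rcases (le_top : s0 ≤ ⊤).lt_or_eq with h | h
    · exact h
    · exfalso
      have : s0 = 1 := h
      rw [this] at hs0
      exact absurd hs0 (not_le.2 h1)
  obtain ⟨c, hc, hcv⟩ : ∃ c ∈ Icc (0 : ℝ) 1, 1 / 2 ≤ |c - (γ s0).1.2 n| := by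
    by_cases hv : (γ s0).1.2 n ≤ 1 / 2
    · exact ⟨1, by simp, by rw [le_abs]; left; linarith⟩
    · exact ⟨0, by simp, by rw [le_abs]; right; linarith⟩
  have hcont : Continuous fun s => (γ s).1.2 n := by fun_prop
  have hev : ∀ᶠ s in 𝓝 s0, |(γ s).1.2 n - (γ s0).1.2 n| < 1 / 2 := by
    have := (hcont.tendsto s0).eventually (Metric.ball_mem_nhds ((γ s0).1.2 n) (by norm_num : (0:ℝ) < 1/2))
    simpa [Real.dist_eq] using this
  obtain ⟨u, hu, hsub⟩ := (mem_nhdsGE_iff_exists_mem_Ioc_Ico_subset hs01).1 (mem_nhdsWithin_of_mem_nhds hev)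
  obtain ⟨s1, hs1, hs1u⟩ := exists_between hu.1
  have hn1 := hgt s1 hs1
  obtain ⟨t, ht, hft⟩ := h.fosc (τ s1 - n) (by linarith) c hc
  have hs0' : τ s0 ≤ n := hs0
  obtain ⟨s, hs, hse⟩ := intermediate_value_Icc hs1.le τ.continuous.continuousOn
    (show (n : ℝ) + t ∈ Icc (τ s0) (τ s1) from ⟨by linarith [ht.1], by linarith [ht.2]⟩)
  have hb : |(γ s).1.2 n - (γ s0).1.2 n| < 1 / 2 := hsub ⟨hs.1, hs.2.trans_lt hs1u⟩
  have hne : (γ s).1.1 ≠ ι n := by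
    rw [hτ, hse]
    intro e
    have := h.inj e
    linarith [ht.1]
  have hv := ((γ s).2 n).2.resolve_left hne
  rw [hτ, hse, ← map_sub, add_sub_cancel_left, hft] at hv
  rw [hv] at hb
  linarith

theorem joined_S [IsTopologicalAddGroup Y] (h : Good ι f) {x y : XS ι f} (hxy : Joined x y) {a : ℝ} (ha : x.1.1 = ι a) :
    ∃ b, y.1.1 = ι b ∧ ⌈b⌉ = ⌈a⌉ := by
  obtain ⟨γ⟩ := hxy
  obtain ⟨θ, hθ⟩ := h.lift ⟨fun s => (γ s).1.1, by fun_prop⟩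
  simp only [ContinuousMap.coe_mk, γ.source, ha, ← map_add] at hθ
  set τ : C(unitInterval, ℝ) := ⟨fun s => a + θ s, by fun_prop⟩ with hτ
  have h0 : τ 0 = a := by
    have := hθ 0
    rw [γ.source, ha] at this
    exact (h.inj this).symm
  have h1 : y.1.1 = ι (τ 1) := by
    have := hθ 1
    rwa [γ.target] at this
  refine ⟨τ 1, h1, ?_⟩
  apply eq_of_forall_ge_iff
  intro n
  rw [Int.ceil_le, Int.ceil_le, ← h0]
  constructor
  · intro hle
    have := cross h (γ.symm : C(unitInterval, XS ι f)) ⟨fun s => τ (unitInterval.symm s), by fun_prop⟩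
      (fun s => hθ (unitInterval.symm s)) n (by simpa using hle)
    simpa using this
  · intro hle
    exact cross h (γ : C(unitInterval, XS ι f)) τ hθ n hle

/-- The special path components. -/
def P (ι : ℝ →+ Y) (f : Y → ℝ) (n : ℤ) : Set (XS ι f) := {x | ∃ t : ℝ, x.1.1 = ι t ∧ ⌈t⌉ = n}

/-- Their closures. -/
def Q (ι : ℝ →+ Y) (f : Y → ℝ) (n : ℤ) : Set (XS ι f) :=
  {x | ∃ t ∈ Icc ((n : ℝ) - 1) n, x.1.1 = ι t}

theorem P_sub_Q (n : ℤ) : P ι f n ⊆ Q ι f n := by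
  rintro x ⟨t, hx, ht⟩
  rw [Int.ceil_eq_iff] at ht
  exact ⟨t, ⟨ht.1.le, ht.2⟩, hx⟩

theorem Q_closed [T2Space Y] (h : Good ι f) (n : ℤ) : IsClosed (Q ι f n) := by
  have : Q ι f n = (fun x : XS ι f => x.1.1) ⁻¹' (ι '' Icc ((n : ℝ) - 1) n) := by
    ext x; constructor
    · rintro ⟨t, ht, e⟩; exact ⟨t, ht, e.symm⟩
    · rintro ⟨t, ht, e⟩; exact ⟨t, ht, e.symm⟩
  rw [this]
  exact (isCompact_Icc.image h.cont).isClosed.preimage (by fun_prop)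

theorem Q_cases {n : ℤ} {x : XS ι f} (hx : x ∈ Q ι f n) : x ∈ P ι f n ∨ x.1.1 = ι ((n - 1 : ℤ) : ℝ) := by
  obtain ⟨t, ht, e⟩ := hx
  rcases ht.1.lt_or_eq with h | h
  · left; exact ⟨t, e, by rw [Int.ceil_eq_iff]; exact ⟨h, ht.2⟩⟩
  · right; rw [e, ← h]; push_cast; rfl

theorem P_unique (h : Good ι f) {n m : ℤ} {x : XS ι f} (hx : x ∈ P ι f n) (hy : x ∈ P ι f m) : n = m := by
  obtain ⟨t, e, rfl⟩ := hx
  obtain ⟨s, e', rfl⟩ := hy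
  rw [e] at e'
  rw [h.inj e']

theorem mem_P_int {n : ℤ} {x : XS ι f} (hx : x.1.1 = ι n) : x ∈ P ι f n := ⟨n, hx, by simp⟩

theorem mem_P_of_joined [IsTopologicalAddGroup Y] (h : Good ι f) {x y : XS ι f} (hxy : Joined x y) {n : ℤ} (hx : x ∈ P ι f n) :
    y ∈ P ι f n := by
  obtain ⟨t, e, rfl⟩ := hx
  obtain ⟨b, hb, hb'⟩ := joined_S h hxy e
  exact ⟨b, hb, hb'⟩

theorem lim_P [IsTopologicalAddGroup Y] (h : Good ι f) (n : ℤ) (x : XS ι f)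
    (hx : x.1.1 = ι ((n - 1 : ℤ) : ℝ)) : x ∈ closure (P ι f n) := by
  refine closure_mono ?_ (lim h _ x hx)
  rintro _ ⟨_, ⟨t, ht, rfl⟩, rfl⟩
  refine ⟨t, rfl, ?_⟩
  push_cast at ht
  rw [Int.ceil_eq_iff]
  exact ⟨ht.1, by linarith [ht.2]⟩

/-- Auxiliary function describing the blown-up coordinate along the special component. -/
noncomputable def g0 (ι : ℝ →+ Y) (f : Y → ℝ) (t : ℝ) : ℝ :=
  if t < 0 then f (ι t) else (Set.projIcc (0 : ℝ) 1 zero_le_one t : ℝ)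

theorem g0_cont (h : Good ι f) : Continuous (g0 ι f) := by
  rw [continuous_iff_continuousAt]
  intro t
  rcases lt_trichotomy t 0 with ht | ht | ht
  · have h1 : ContinuousAt (fun t => f (ι t)) t :=
      ContinuousAt.comp (f := fun t => ι t) (h.fcont _ (fun e => ht.ne (h.inj (e.trans (map_zero ι).symm))))
        h.cont.continuousAt
    refine h1.congr ?_
    filter_upwards [gt_mem_nhds ht] with s hs
    simp [g0, hs]
  · subst ht
    rw [continuousAt_iff_continuous_left'_right']
    have e0 : g0 ι f 0 = 0 := by simp [g0]
    constructor
    · unfold ContinuousWithinAt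
      rw [e0]
      refine h.fleft.congr' ?_
      filter_upwards [self_mem_nhdsWithin] with s hs
      simp [g0, mem_Iio.1 hs]
    · have h1 : Continuous (fun t : ℝ => (Set.projIcc (0 : ℝ) 1 zero_le_one t : ℝ)) := by fun_prop
      refine h1.continuousWithinAt.congr ?_ ?_
      · intro s hs
        simp [g0, not_lt.2 (mem_Ioi.1 hs).le]
      · simp [g0]
  · have h1 : Continuous (fun t : ℝ => (Set.projIcc (0 : ℝ) 1 zero_le_one t : ℝ)) := by fun_prop
    refine h1.continuousAt.congr ?_
    filter_upwards [lt_mem_nhds ht] with s hs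
    simp [g0, not_lt.2 hs.le]

theorem g0_range (h : Good ι f) (t : ℝ) : g0 ι f t ∈ Icc (0 : ℝ) 1 := by
  unfold g0
  split_ifs
  · exact h.frange _
  · exact Subtype.coe_prop _

/-- Parametrisation of the special component. -/
noncomputable def p (h : Good ι f) (n : ℤ) (t : ℝ) : XS ι f :=
  ⟨(ι (min t n), fun m => if m = n then g0 ι f (t - n) else f (ι (min t n) - ι m)), by
    intro m
    dsimp only
    split_ifs with hm
    · subst hm
      refine ⟨g0_range h _, ?_⟩
      rcases lt_or_ge t (m : ℝ) with ht | ht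
      · right
        rw [min_eq_left ht.le]
        simp [g0, ht]
      · left
        rw [min_eq_right ht]
    · exact ⟨h.frange _, Or.inr rfl⟩⟩

theorem p_fst (h : Good ι f) (n : ℤ) (t : ℝ) : (p h n t).1.1 = ι (min t n) := rfl

theorem p_cont [IsTopologicalAddGroup Y] (h : Good ι f) (n : ℤ) : ContinuousOn (p h n) (Ioi ((n : ℝ) - 1)) := by
  intro t ht
  refine ContinuousAt.continuousWithinAt ?_
  have hι : Continuous fun t : ℝ => ι (min t n) := h.cont.comp (by fun_prop)
  refine tendsto_subtype_rng.2 (Tendsto.prodMk_nhds hι.continuousAt ?_)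
  rw [tendsto_pi_nhds]
  intro m
  by_cases hm : m = n
  · simp only [hm, if_true]
    exact ((g0_cont h).comp (by fun_prop : Continuous fun t : ℝ => t - n)).continuousAt
  · simp only [hm, if_false]
    have hne : ι (min t n) - ι m ≠ 0 := by
      rw [sub_ne_zero]
      intro e
      have e := h.inj e
      have h1 : (n : ℝ) - 1 < m := by rw [← e]; exact lt_min ht (by linarith)
      have h2 : (m : ℝ) ≤ n := by rw [← e]; exact min_le_right _ _
      have h3 : n - 1 < m := by exact_mod_cast h1
      have h4 : m ≤ n := by exact_mod_cast h2
      omega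
    exact (h.fcont _ hne).tendsto.comp (hι.continuousAt.tendsto.sub_const _)

theorem p_mem (h : Good ι f) (n : ℤ) {t : ℝ} (ht : (n : ℝ) - 1 < t) : p h n t ∈ P ι f n := by
  refine ⟨min t n, rfl, ?_⟩
  rw [Int.ceil_eq_iff]
  exact ⟨lt_min ht (by linarith), min_le_right _ _⟩

theorem p_surj (h : Good ι f) (n : ℤ) {x : XS ι f} (hx : x ∈ P ι f n) :
    ∃ t ∈ Ioc ((n : ℝ) - 1) (n + 1), p h n t = x := by
  obtain ⟨t, e, ht⟩ := hx
  rw [Int.ceil_eq_iff] at ht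
  have key : ∀ m : ℤ, m ≠ n → t ≠ m := by
    rintro m hm rfl
    apply hm
    have h1 : n - 1 < m := by exact_mod_cast ht.1
    have h2 : m ≤ n := by exact_mod_cast ht.2
    omega
  have key2 : ∀ m : ℤ, m ≠ n → x.1.2 m = f (ι t - ι m) := by
    intro m hm
    rw [← e]
    refine (x.2 m).2.resolve_left ?_
    rw [e]
    exact fun e => key m hm (h.inj e)
  rcases ht.2.lt_or_eq with h1 | h1
  · refine ⟨t, ⟨ht.1, by linarith⟩, ?_⟩
    apply Subtype.ext
    apply Prod.ext
    · rw [p_fst, e, min_eq_left h1.le]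
    · funext m
      simp only [p]
      rw [min_eq_left h1.le]
      split_ifs with hm
      · subst hm
        have : x.1.2 m = f (x.1.1 - ι m) := by
          refine (x.2 m).2.resolve_left ?_
          rw [e]
          exact fun e => h1.ne (h.inj e)
        rw [this, e, g0, if_pos (by linarith), map_sub]
      · exact (key2 m hm).symm
  · have hv := (x.2 n).1
    refine ⟨n + x.1.2 n, ⟨by linarith [hv.1], by linarith [hv.2]⟩, ?_⟩
    have hmin : min ((n : ℝ) + x.1.2 n) n = n := min_eq_right (by linarith [hv.1])
    apply Subtype.ext
    apply Prod.ext
    · rw [p_fst, e, hmin, h1]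
    · funext m
      simp only [p]
      rw [hmin]
      split_ifs with hm
      · subst hm
        rw [g0, if_neg (by linarith [hv.1]), add_sub_cancel_left, projIcc_of_mem _ hv]
      · rw [key2 m hm, h1]

theorem p_inj (h : Good ι f) (n : ℤ) : InjOn (p h n) (Iic ((n : ℝ) + 1)) := by
  intro s hs t ht e
  have e1 : min s (n : ℝ) = min t n := h.inj (by rw [← p_fst h, ← p_fst h, e])
  have e2 : g0 ι f (s - n) = g0 ι f (t - n) := by
    have : (p h n s).1.2 n = (p h n t).1.2 n := by rw [e]
    simpa [p] using this
  simp only [mem_Iic] at hs ht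
  rcases lt_or_ge s (n : ℝ) with h1 | h1
  · rw [min_eq_left h1.le] at e1
    rcases lt_or_ge t (n : ℝ) with h2 | h2
    · rwa [min_eq_left h2.le] at e1
    · rw [min_eq_right h2] at e1; linarith
  · rw [min_eq_right h1] at e1
    rcases lt_or_ge t (n : ℝ) with h2 | h2
    · rw [min_eq_left h2.le] at e1; linarith
    · rw [g0, g0, if_neg (by linarith), if_neg (by linarith),
        projIcc_of_mem _ (show s - n ∈ Icc (0 : ℝ) 1 from ⟨by linarith, by linarith⟩),
        projIcc_of_mem _ (show t - n ∈ Icc (0 : ℝ) 1 from ⟨by linarith, by linarith⟩)] at e2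
      simp only at e2
      linarith

theorem joined_P [IsTopologicalAddGroup Y] (h : Good ι f) {n : ℤ} {x y : XS ι f} (hx : x ∈ P ι f n)
    (hy : y ∈ P ι f n) : Joined x y := by
  obtain ⟨s, hs, rfl⟩ := p_surj h n hx
  obtain ⟨t, ht, rfl⟩ := p_surj h n hy
  have hp : IsPathConnected (p h n '' Ioi ((n : ℝ) - 1)) :=
    ((convex_Ioi _).isPathConnected ⟨(n : ℝ), by simp⟩).image' (p_cont h n)
  exact (hp.joinedIn _ ⟨s, hs.1, rfl⟩ _ ⟨t, ht.1, rfl⟩).joined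

theorem joined_shift [IsTopologicalAddGroup Y] (h : Good ι f) {x : XS ι f} (hx : ∀ t, x.1.1 ≠ ι t) (k : ℤ) :
    Joined x (S ι f k x) := by
  have hoff : ∀ s : ℝ, ∀ n : ℤ, x.1.1 + ι s ≠ ι n := by
    intro s n e
    apply hx (n - s)
    rw [map_sub, ← e]; abel
  have hc : Continuous fun s : ℝ => G h (x.1.1 + ι s) := by
    rw [continuous_iff_continuousAt]
    intro s
    have h1 : Continuous fun s : ℝ => x.1.1 + ι s := continuous_const.add h.cont
    exact ContinuousAt.comp (f := fun s : ℝ => x.1.1 + ι s) (G_contAt h _ (hoff s)) h1.continuousAt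
  have hp : IsPathConnected ((fun s : ℝ => G h (x.1.1 + ι s)) '' univ) :=
    isPathConnected_univ.image hc
  have e0 : G h (x.1.1 + ι 0) = x := by
    rw [map_zero, add_zero]; exact (eq_G h x fun n => hx n).symm
  have e1 : G h (x.1.1 + ι k) = S ι f k x :=
    (eq_G h (S ι f k x) fun n => hoff k n).symm
  have := (hp.joinedIn _ ⟨0, trivial, rfl⟩ _ ⟨(k : ℝ), trivial, rfl⟩).joined
  simp only [e0, e1] at this
  exact this

theorem ext_int (h : Good ι f) {n : ℤ} {x y : XS ι f} (hx : x.1.1 = ι n) (hy : y.1.1 = ι n)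
    (hxy : x.1.2 n = y.1.2 n) : x = y := by
  apply Subtype.ext
  apply Prod.ext
  · rw [hx, hy]
  · funext m
    by_cases hm : m = n
    · rw [hm, hxy]
    · have hne : ι n ≠ ι m := fun e => hm (by exact_mod_cast (h.inj e).symm)
      rw [(x.2 m).2.resolve_left (by rwa [hx]), (y.2 m).2.resolve_left (by rwa [hy]), hx, hy]

theorem fixed_of_P [IsTopologicalAddGroup Y] [T2Space Y] [CompactSpace Y] (h : Good ι f)
    (φ : XS ι f → XS ι f) (hφ : Continuous φ) (n : ℤ) (hP : ∀ x ∈ P ι f n, φ x ∈ P ι f n) :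
    ∃ x, φ x = x := by
  have : CompactSpace (XS ι f) := isCompact_iff_compactSpace.1 (isCompact_XS h)
  have hQA : ∀ x : XS ι f, x.1.1 = ι ((n - 1 : ℤ) : ℝ) → φ x ∈ Q ι f n := by
    intro x hx
    have h1 : closure (P ι f n) ⊆ φ ⁻¹' (Q ι f n) :=
      closure_minimal (fun z hz => P_sub_Q n (hP z hz)) ((Q_closed h n).preimage hφ)
    exact h1 (lim_P h n x hx)
  by_cases hA : ∀ x : XS ι f, x.1.1 = ι ((n - 1 : ℤ) : ℝ) → (φ x).1.1 = ι ((n - 1 : ℤ) : ℝ)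
  · set k : ℤ := n - 1 with hk
    set q : ℝ → XS ι f := fun v => p h k (k + v) with hq
    have hq1 : ∀ v, 0 ≤ v → (q v).1.1 = ι k := by
      intro v hv
      rw [hq]; simp only [p_fst]; rw [min_eq_right (by linarith)]
    have hqc : ContinuousOn q (Icc 0 1) := by
      refine (p_cont h k).comp (by fun_prop) ?_
      intro v hv
      simp only [mem_Ioi]; linarith [hv.1]
    have hq2 : ∀ v ∈ Icc (0 : ℝ) 1, (q v).1.2 k = v := by
      intro v hv
      simp only [hq, p, if_true]
      rw [g0, if_neg (by linarith [hv.1]), add_sub_cancel_left, projIcc_of_mem _ hv]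
    have hcc : Continuous fun x : XS ι f => (φ x).1.2 k := by fun_prop
    obtain ⟨v, hv, hfix⟩ := exists_mem_Icc_isFixedPt_of_mapsTo (f := fun v => (φ (q v)).1.2 k)
      (hcc.comp_continuousOn hqc) zero_le_one (fun v _ => ((φ (q v)).2 k).1)
    refine ⟨q v, ext_int h (hA _ (hq1 v hv.1)) (hq1 v hv.1) ?_⟩
    rw [hq2 v hv]
    exact hfix
  · push Not at hA
    obtain ⟨x0, hx0, hx0'⟩ := hA
    have hx0P : φ x0 ∈ P ι f n := (Q_cases (hQA x0 hx0)).resolve_right hx0'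
    have hQP : ∀ x ∈ Q ι f n, φ x ∈ P ι f n := by
      intro x hx
      rcases Q_cases hx with h1 | h1
      · exact hP x h1
      · exact mem_P_of_joined h ((joined_P h (mem_P_int hx0) (mem_P_int h1)).map hφ) hx0P
    set B : Set ℝ := Icc ((n : ℝ) - 1) n ∩ ι ⁻¹' ((fun x => (φ x).1.1) '' Q ι f n) with hB
    have hBc : IsCompact B := by
      refine isCompact_Icc.inter_right (IsClosed.preimage h.cont ?_)
      exact ((Q_closed h n).isCompact.image (by fun_prop)).isClosed
    have hBm : ∀ x ∈ Q ι f n, ∀ t : ℝ, (n : ℝ) - 1 ≤ t → t ≤ n → (φ x).1.1 = ι t → t ∈ B :=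
      fun x hx t h1 h2 h3 => ⟨⟨h1, h2⟩, ⟨x, hx, h3⟩⟩
    have hBl : ∀ t ∈ B, (n : ℝ) - 1 < t := by
      rintro t ⟨ht, x, hx, e⟩
      obtain ⟨s, hs, hs'⟩ := hQP x hx
      have : s = t := h.inj (hs.symm.trans e)
      rw [this, Int.ceil_eq_iff] at hs'
      exact hs'.1
    have hBne : B.Nonempty := by
      obtain ⟨t, ht, ht'⟩ := hQP _ (P_sub_Q n (p_mem h n (t := n) (by linarith)))
      rw [Int.ceil_eq_iff] at ht'
      exact ⟨t, hBm _ (P_sub_Q n (p_mem h n (t := n) (by linarith))) t ht'.1.le ht'.2 ht⟩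
    obtain ⟨b, hb, hbmin⟩ := hBc.exists_isLeast hBne
    have hbn := hBl b hb
    have hbn' : b ≤ n := hb.1.2
    have hex : ∀ t : Icc b ((n : ℝ) + 1), ∃ s : Icc b ((n : ℝ) + 1), p h n s = φ (p h n t) := by
      intro t
      have hQt : p h n t ∈ Q ι f n := P_sub_Q n (p_mem h n (hbn.trans_le t.2.1))
      obtain ⟨s, hs, e⟩ := p_surj h n (hQP _ hQt)
      refine ⟨⟨s, ?_, hs.2⟩, e⟩
      have hm : min s (n : ℝ) ∈ B := by
        refine hBm _ hQt _ (le_min hs.1.le (by linarith)) (min_le_right _ _) ?_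
        rw [← e, p_fst]
      exact (hbmin hm).trans (min_le_left _ _)
    choose H hH using hex
    set q : Icc b ((n : ℝ) + 1) → XS ι f := fun t => p h n t with hq
    have hqc : Continuous q := by
      refine continuousOn_iff_continuous_domRestrict.1 ((p_cont h n).mono ?_)
      intro t ht
      exact hbn.trans_le ht.1
    have hqi : Function.Injective q := by
      intro s t e
      exact Subtype.ext (p_inj h n s.2.2 t.2.2 e)
    have hemb := hqc.isClosedEmbedding hqi
    have hHc : Continuous H := by
      rw [hemb.isEmbedding.continuous_iff]
      have : q ∘ H = φ ∘ q := by funext t; exact hH t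
      rw [this]
      exact hφ.comp hqc
    have hle : b ≤ (n : ℝ) + 1 := by linarith
    obtain ⟨t, ht, hfix⟩ := exists_mem_Icc_isFixedPt_of_mapsTo
      (f := fun t => (H (projIcc b ((n : ℝ) + 1) hle t) : ℝ)) (a := b) (b := (n : ℝ) + 1)
      (Continuous.continuousOn (by fun_prop)) hle (fun t _ => Subtype.coe_prop _)
    refine ⟨p h n t, ?_⟩
    have h1 := hH ⟨t, ht⟩
    have h2 : (H (projIcc b ((n : ℝ) + 1) hle t) : ℝ) = t := hfix
    rw [projIcc_of_mem hle ht] at h2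
    rw [h2] at h1
    exact h1.symm

theorem int_lemma (d : ℤ → ℤ) (hd : ∀ n, d (n + 1) = d n ∨ d (n + 1) = d n - 1) (h0 : ∀ n, d n ≠ 0) :
    ∃ N : ℤ, (∀ n, N ≤ n → d n = d N) ∨ (∀ n, n ≤ N → d n = d N) := by
  have hanti : Antitone d := antitone_int_of_succ_le fun n => by rcases hd n with h | h <;> omega
  rcases lt_or_gt_of_ne (h0 0) with hneg | hpos
  · have hall : ∀ n, d n ≤ 0 := by
      intro n
      by_contra! hc
      have : ∀ m, n ≤ m → 0 < d m := by
        intro m hm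
        induction m, hm using Int.leInduction with
        | base => exact hc
        | succ m hm ih => have := h0 (m + 1); rcases hd m with h | h <;> omega
      have hn : n ≤ 0 := by
        by_contra! h2
        have := hanti h2.le
        omega
      have := this 0 hn
      omega
    obtain ⟨D, ⟨N, hN⟩, hmax⟩ := Int.exists_greatest_of_bdd (P := fun z => ∃ n, d n = z)
      ⟨0, by rintro z ⟨n, rfl⟩; exact hall n⟩ ⟨_, 0, rfl⟩
    refine ⟨N, Or.inr fun n hn => ?_⟩
    have h1 := hmax (d n) ⟨n, rfl⟩
    have h2 := hanti hn
    omega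
  · have hall : ∀ n, 0 ≤ d n := by
      intro n
      rcases le_total n 0 with hn | hn
      · have := hanti hn; omega
      · have : 0 < d n := by
          induction n, hn using Int.leInduction with
          | base => exact hpos
          | succ m hm ih => have := h0 (m + 1); rcases hd m with h | h <;> omega
        exact this.le
    obtain ⟨D, ⟨N, hN⟩, hmin⟩ := Int.exists_least_of_bdd (P := fun z => ∃ n, d n = z)
      ⟨0, by rintro z ⟨n, rfl⟩; exact hall n⟩ ⟨_, 0, rfl⟩
    refine ⟨N, Or.inl fun n hn => ?_⟩
    have h1 := hmin (d n) ⟨n, rfl⟩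
    have h2 := hanti hn
    omega

theorem dichotomy [IsTopologicalAddGroup Y] [T2Space Y] [CompactSpace Y] (h : Good ι f)
    (φ : XS ι f → XS ι f) (hφ : Continuous φ) (hs : Function.Surjective φ) :
    (IsHomeomorph φ ∧ IsMinimal φ) ∨ ∃ x, φ x = x := by
  by_cases hfp : ∃ x, φ x = x
  · exact Or.inr hfp
  left
  -- points off the special composant stay off it
  have hoff : ∀ x : XS ι f, (∀ t, x.1.1 ≠ ι t) → ∀ m, φ x ∉ P ι f m := by
    intro x hx m hm
    have h1 : ∀ k : ℤ, φ (S ι f k x) ∈ Q ι f m := fun k =>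
      P_sub_Q m (mem_P_of_joined h ((joined_shift h hx k).map hφ) hm)
    have h2 : ∀ z, φ z ∈ Q ι f m := by
      intro z
      refine closure_minimal (t := φ ⁻¹' (Q ι f m)) ?_ ((Q_closed h m).preimage hφ) (minimal_S h 1 one_ne_zero x z)
      rintro _ ⟨j, rfl⟩
      simp only [S_iter]
      exact h1 _
    obtain ⟨y, hy⟩ := h.off
    obtain ⟨z, hz⟩ := hs (G h y)
    obtain ⟨t, -, ht⟩ := h2 z
    rw [hz] at ht
    exact hy t ht
  have hex : ∀ n : ℤ, ∃ x : XS ι f, x.1.1 = ι n := fun n => ⟨G h (ι n), rfl⟩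
  set R : ℤ → ℤ → Prop := fun n m => ∀ x ∈ P ι f n, φ x ∈ P ι f m with hR
  have hR1 : ∀ n m x, x ∈ P ι f n → φ x ∈ P ι f m → R n m := fun n m x hx hm z hz =>
    mem_P_of_joined h ((joined_P h hx hz).map hφ) hm
  have hRu : ∀ n m m', R n m → R n m' → m = m' := by
    intro n m m' h1 h2
    obtain ⟨x, hx⟩ := hex n
    exact P_unique h (h1 x (mem_P_int hx)) (h2 x (mem_P_int hx))
  have hRQ : ∀ n m, R (n + 1) m → ∀ x : XS ι f, x.1.1 = ι n → φ x ∈ Q ι f m := by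
    intro n m hnm x hx
    have h1 : closure (P ι f (n + 1)) ⊆ φ ⁻¹' (Q ι f m) :=
      closure_minimal (fun z hz => P_sub_Q m (hnm z hz)) ((Q_closed h m).preimage hφ)
    exact h1 (lim_P h (n + 1) x (by simpa using hx))
  have hRd : ∀ n m, R (n + 1) m → R n m ∨ R n (m - 1) := by
    intro n m hnm
    obtain ⟨x, hx⟩ := hex n
    rcases Q_cases (hRQ n m hnm x hx) with h1 | h1
    · left; exact hR1 n m x (mem_P_int hx) h1
    · right; exact hR1 n (m - 1) x (mem_P_int hx) (mem_P_int h1)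
  have hRs : ∀ m, ∃ n, R n m := by
    intro m
    obtain ⟨z, hz⟩ := hex m
    obtain ⟨x, rfl⟩ := hs z
    by_cases hx : ∀ t, x.1.1 ≠ ι t
    · exact absurd (mem_P_int hz) (hoff x hx m)
    · push Not at hx
      obtain ⟨t, ht⟩ := hx
      exact ⟨⌈t⌉, hR1 _ _ x ⟨t, ht, rfl⟩ (mem_P_int hz)⟩
  have hRdown : ∀ n' m', R n' m' → ∀ n, n ≤ n' → ∃ m ≤ m', R n m := by
    intro n' m' hh n hn
    induction n, hn using Int.leInductionDown with
    | base => exact ⟨m', le_rfl, hh⟩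
    | pred k hk ih =>
      obtain ⟨m, hm, hkm⟩ := ih
      rcases hRd (k - 1) m (by simpa using hkm) with h1 | h1
      · exact ⟨m, hm, h1⟩
      · exact ⟨m - 1, by omega, h1⟩
  have hRall : ∀ n, ∃ m, R n m := by
    by_contra! hc
    obtain ⟨n0, hn0⟩ := hc
    obtain ⟨N, ⟨M, hNM⟩, hmax⟩ := Int.exists_greatest_of_bdd (P := fun n => ∃ m, R n m)
      ⟨n0, by
        rintro z ⟨m, hm⟩
        by_contra! hlt
        obtain ⟨m', -, hm'⟩ := hRdown z m hm n0 hlt.le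
        exact hn0 m' hm'⟩ (by obtain ⟨n, hn⟩ := hRs 0; exact ⟨n, 0, hn⟩)
    obtain ⟨n, hn⟩ := hRs (M + 1)
    obtain ⟨m, hm, hnm⟩ := hRdown N M hNM n (hmax n ⟨_, hn⟩)
    have := hRu n _ _ hn hnm
    omega
  choose σ hσ using hRall
  have hσstep : ∀ n, σ n = σ (n + 1) ∨ σ n = σ (n + 1) - 1 := by
    intro n
    rcases hRd n _ (hσ (n + 1)) with h1 | h1
    · left; exact hRu _ _ _ (hσ n) h1
    · right; exact hRu _ _ _ (hσ n) h1
  have hne : ∀ n, σ n - n ≠ 0 := by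
    intro n hn
    have e : σ n = n := by omega
    apply hfp
    refine fixed_of_P h φ hφ n ?_
    have := hσ n
    rwa [e] at this
  obtain ⟨N, hN⟩ := int_lemma (fun n => σ n - n) (fun n => by
    have := hσstep n
    omega) hne
  set D : ℤ := σ N - N with hD
  have hD0 : D ≠ 0 := hne N
  have hstep : ∀ n, σ n - n = D → σ (n + 1) - (n + 1) = D → ∀ x : XS ι f, x.1.1 = ι n →
      (φ x).1.1 = x.1.1 + ι D := by
    intro n h1 h2 x hx
    have h3 := hσ n x (mem_P_int hx)
    rcases Q_cases (hRQ n _ (hσ (n + 1)) x hx) with h4 | h4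
    · have := P_unique h h3 h4
      omega
    · rw [h4, hx, ← map_add]
      congr 1
      have : σ (n + 1) - 1 = n + D := by omega
      rw [this]; push_cast; rfl
  have hcl : IsClosed {x : XS ι f | (φ x).1.1 = x.1.1 + ι D} :=
    isClosed_eq (by fun_prop) (by fun_prop)
  obtain ⟨x0, hx0⟩ := hex 0
  have hSx : ∀ n : ℤ, (S ι f n x0).1.1 = ι n := by
    intro n; rw [S_fst, hx0]; simp
  have hU : ∀ x : XS ι f, (φ x).1.1 = x.1.1 + ι D := by
    rcases hN with hN | hN
    · intro z
      refine closure_minimal ?_ hcl (minimal_S h 1 one_ne_zero (S ι f N x0) z)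
      rintro _ ⟨j, rfl⟩
      simp only [S_iter, S_add]
      exact hstep _ (hN _ (by omega)) (hN _ (by omega)) _ (hSx _)
    · intro z
      refine closure_minimal ?_ hcl (minimal_S h (-1) (by norm_num) (S ι f (N - 1) x0) z)
      rintro _ ⟨j, rfl⟩
      simp only [S_iter, S_add]
      exact hstep _ (hN _ (by omega)) (hN _ (by omega)) _ (hSx _)
  have hfin : φ = S ι f D := by
    refine Continuous.ext_on (dense_G h) hφ (S_cont D) ?_
    rintro _ ⟨y, hy, rfl⟩
    have hyD : ∀ n : ℤ, y + ι D ≠ ι n := by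
      intro n e
      apply hy (n - D)
      push_cast
      rw [map_sub, ← e]; abel
    have h1 : (φ (G h y)).1.1 = y + ι D := hU _
    have h2 : (S ι f D (G h y)).1.1 = y + ι D := rfl
    rw [eq_G h (φ (G h y)) (by rwa [h1]), eq_G h (S ι f D (G h y)) (by rwa [h2]), h1, h2]
  rw [hfin]
  exact ⟨(SH ι f D).isHomeomorph, minimal_S h D hD0⟩

theorem connected_XS [IsTopologicalAddGroup Y] [T2Space Y] [CompactSpace Y] (h : Good ι f) :
    ConnectedSpace (XS ι f) := by
  obtain ⟨y, hy⟩ := h.off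
  have hpc : IsPreconnected (closure (pathComponent (G h y))) :=
    isPathConnected_pathComponent.isConnected.isPreconnected.closure
  have : closure (pathComponent (G h y)) = univ := by
    refine Dense.closure_eq ((minimal_S h 1 one_ne_zero (G h y)).mono ?_)
    rintro _ ⟨j, rfl⟩
    simp only [S_iter]
    exact joined_shift h hy _
  rw [this] at hpc
  exact { isPreconnected_univ := hpc, toNonempty := ⟨G h y⟩ }

end abstractPart

section solenoid

local instance factOne : Fact ((0 : ℝ) < 1) := ⟨one_pos⟩

/-- The dyadic solenoid. -/
def Sol : AddSubgroup (ℕ → AddCircle (1 : ℝ)) where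
  carrier := {z | ∀ k, (2 : ℕ) • z (k + 1) = z k}
  zero_mem' := by intro k; simp
  add_mem' := by
    intro a b ha hb k
    rw [Pi.add_apply, nsmul_add, ha k, hb k]; rfl
  neg_mem' := by
    intro a ha k
    rw [Pi.neg_apply, smul_neg, ha k]; rfl

theorem sol_closed : IsClosed (Sol : Set (ℕ → AddCircle (1 : ℝ))) := by
  have : (Sol : Set (ℕ → AddCircle (1 : ℝ))) = ⋂ k, {z | (2 : ℕ) • z (k + 1) = z k} := by
    ext z; simp only [mem_iInter]; rfl
  rw [this]
  exact isClosed_iInter fun k => isClosed_eq (by fun_prop) (by fun_prop)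

instance : CompactSpace Sol := isCompact_iff_compactSpace.1 sol_closed.isCompact

theorem coord_cont (k : ℕ) : Continuous fun y : Sol => y.1 k :=
  (continuous_apply k).comp continuous_subtype_val

instance : TopologicalSpace.MetrizableSpace Sol := by
  have : TopologicalSpace.MetrizableSpace (ℕ → AddCircle (1 : ℝ)) := UniformSpace.metrizableSpace
  exact Topology.IsEmbedding.subtypeVal.metrizableSpace

/-- The one-parameter subgroup. -/
noncomputable def io : ℝ →+ Sol where
  toFun t := ⟨fun k => ((t * √2 / 2 ^ k : ℝ) : AddCircle (1 : ℝ)), by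
    intro k
    rw [← AddCircle.coe_nsmul]
    congr 1
    rw [pow_succ, nsmul_eq_mul]; push_cast; field_simp⟩
  map_zero' := by
    apply Subtype.ext; funext k; simp
  map_add' s t := by
    apply Subtype.ext; funext k
    simp only [AddSubgroup.coe_add, Pi.add_apply]
    rw [← AddCircle.coe_add]
    congr 1; ring

theorem io_apply (t : ℝ) (k : ℕ) : (io t).1 k = ((t * √2 / 2 ^ k : ℝ) : AddCircle (1 : ℝ)) := rfl

theorem io_cont : Continuous io := by
  refine Continuous.subtype_mk (continuous_pi fun k => ?_) _
  exact (AddCircle.continuous_mk' (1 : ℝ)).comp (by fun_prop)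

theorem io_inj : Function.Injective io := by
  rw [injective_iff_map_eq_zero]
  intro t ht
  obtain ⟨k, hk⟩ := pow_unbounded_of_one_lt (|t * √2|) (one_lt_two)
  have h1 : ((t * √2 / 2 ^ k : ℝ) : AddCircle (1 : ℝ)) = 0 := by
    rw [← io_apply, ht]; rfl
  rw [AddCircle.coe_eq_zero_iff] at h1
  obtain ⟨n, hn⟩ := h1
  have h2 : |(n : ℝ)| < 1 := by
    have : (n : ℝ) = t * √2 / 2 ^ k := by simpa using hn
    rw [this, abs_div, abs_of_pos (by positivity : (0 : ℝ) < 2 ^ k), div_lt_one (by positivity)]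
    exact hk
  have h3 : n = 0 := by
    have : |n| < 1 := by exact_mod_cast h2
    exact Int.abs_lt_one_iff.1 this
  rw [h3] at hn
  simp only [zero_smul] at hn
  have h4 : t * √2 = 0 := by
    have h5 : (2 : ℝ) ^ k ≠ 0 := by positivity
    field_simp at hn
    simpa using hn.symm
  rcases mul_eq_zero.1 h4 with h | h
  · exact h
  · simp at h

theorem io_lift (γ : C(unitInterval, Sol)) :
    ∃ θ : C(unitInterval, ℝ), ∀ s, γ s = γ 0 + io (θ s) := by
  have cov := AddCircle.isCoveringMap_coe (1 : ℝ)
  have hL : ∀ k : ℕ, ∃ L : C(unitInterval, ℝ),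
      (∀ s, ((L s : ℝ) : AddCircle (1 : ℝ)) = (γ s).1 k - (γ 0).1 k) ∧ L 0 = 0 := by
    intro k
    obtain ⟨L, hL, hL0⟩ := cov.exists_path_lifts
      ⟨fun s => (γ s).1 k - (γ 0).1 k, ((coord_cont k).comp γ.continuous).sub continuous_const⟩ 0 (by simp)
    exact ⟨L, fun s => congrFun hL s, hL0⟩
  choose L hL hL0 using hL
  have hstep : ∀ k s, 2 * L (k + 1) s = L k s := by
    intro k
    have := cov.eq_of_comp_eq (A := unitInterval) (g₁ := fun s => 2 * L (k + 1) s)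
      (g₂ := fun s => L k s) (by fun_prop) (by fun_prop) (by
        funext s
        simp only [Function.comp]
        rw [hL k s, ← (γ s).2 k, ← (γ 0).2 k, ← nsmul_sub, ← hL (k + 1) s, ← AddCircle.coe_nsmul]
        simp) 0 (by simp [hL0])
    exact fun s => congrFun this s
  have hall : ∀ k s, L k s = L 0 s / 2 ^ k := by
    intro k s
    induction k with
    | zero => simp
    | succ k ih =>
      have := hstep k s
      rw [ih] at this
      rw [pow_succ]
      field_simp
      field_simp at this
      linarith
  refine ⟨⟨fun s => L 0 s / √2, by fun_prop⟩, fun s => ?_⟩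
  apply Subtype.ext
  funext k
  simp only [AddSubgroup.coe_add, Pi.add_apply, io_apply, ContinuousMap.coe_mk]
  rw [div_mul_cancel₀ _ (by positivity), ← hall, hL]
  abel

theorem sol_pow (z : Sol) (k j : ℕ) : z.1 k = (2 ^ j : ℕ) • z.1 (k + j) := by
  induction j with
  | zero => simp
  | succ j ih =>
    rw [ih, ← z.2 (k + j), ← mul_nsmul', pow_succ]; rfl

theorem io_dense (D : ℤ) (hD : D ≠ 0) : DenseRange (fun n : ℕ => n • io (D : ℝ)) := by
  rw [← denseRange_zsmul_iff_nsmul]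
  intro y
  have hd : ∀ K : ℕ, ∃ n : ℤ, ‖(n • io (D : ℝ)).1 K - y.1 K‖ < (1 / 4 : ℝ) ^ K := by
    intro K
    have hirr : Irrational (((D : ℝ) * √2 / 2 ^ K) / 1) := by
      have h1 := (irrational_sqrt_two.intCast_mul hD).div_natCast (m := 2 ^ K) (by positivity)
      push_cast at h1
      simpa using h1
    have hdr := AddCircle.denseRange_zsmul_coe_iff.2 hirr
    obtain ⟨n, hn⟩ := hdr.exists_dist_lt (y.1 K) (by positivity : (0 : ℝ) < (1 / 4) ^ K)
    refine ⟨n, ?_⟩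
    rw [dist_comm, dist_eq_norm] at hn
    exact hn
  choose n hn using hd
  refine mem_closure_of_tendsto (f := fun K => n K • io (D : ℝ)) (b := atTop) ?_
    (Eventually.of_forall fun K => ⟨n K, rfl⟩)
  rw [tendsto_subtype_rng, tendsto_pi_nhds]
  intro k
  rw [← tendsto_add_atTop_iff_nat k, tendsto_iff_norm_sub_tendsto_zero]
  have hb : ∀ j : ℕ, ‖(n (j + k) • io (D : ℝ)).1 k - y.1 k‖ ≤ (1 / 2 : ℝ) ^ j := by
    intro j
    have e : (n (j + k) • io (D : ℝ)).1 k - y.1 k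
        = (2 ^ j : ℕ) • ((n (j + k) • io (D : ℝ)).1 (j + k) - y.1 (j + k)) := by
      have := sol_pow (n (j + k) • io (D : ℝ) - y) k j
      rw [add_comm k j] at this
      exact this
    rw [e]
    refine (norm_nsmul_le).trans ?_
    have h1 := (hn (j + k)).le
    calc ((2 ^ j : ℕ) : ℝ) * _ ≤ ((2 ^ j : ℕ) : ℝ) * (1 / 4) ^ (j + k) := by gcongr
      _ ≤ ((2 ^ j : ℕ) : ℝ) * (1 / 4) ^ j := by
        gcongr ?_ * ?_
        exact pow_le_pow_of_le_one (by norm_num) (by norm_num) (by omega)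
      _ = (1 / 2) ^ j := by
        push_cast; rw [← mul_pow]; norm_num
  exact squeeze_zero (fun _ => norm_nonneg _) hb
    (tendsto_pow_atTop_nhds_zero_of_lt_one (by norm_num) (by norm_num))

theorem io_off : ∃ y : Sol, ∀ t, y ≠ io t := by
  refine ⟨⟨fun k => (((-1) ^ k / 3 : ℝ) : AddCircle (1 : ℝ)), ?_⟩, ?_⟩
  · intro k
    rw [← AddCircle.coe_nsmul, ← sub_eq_zero, ← AddCircle.coe_sub, AddCircle.coe_eq_zero_iff]
    refine ⟨-(-1) ^ k, ?_⟩
    simp only [zsmul_eq_mul, nsmul_eq_mul, pow_succ]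
    push_cast
    ring
  · intro t e
    have h3 : io (3 * t) = 0 := by
      have : io (3 * t) = 3 • io t := by rw [← map_nsmul]; congr 1; simp
      rw [this, ← e]
      apply Subtype.ext
      funext k
      change 3 • (((-1) ^ k / 3 : ℝ) : AddCircle (1 : ℝ)) = 0
      rw [← AddCircle.coe_nsmul, AddCircle.coe_eq_zero_iff]
      refine ⟨(-1) ^ k, ?_⟩
      simp only [zsmul_eq_mul, nsmul_eq_mul]
      push_cast
      ring
    have ht : t = 0 := by
      have := io_inj (h3.trans (map_zero io).symm)
      linarith
    rw [ht, map_zero] at e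
    have h0 : (((-1) ^ 0 / 3 : ℝ) : AddCircle (1 : ℝ)) = 0 := congrFun (congrArg Subtype.val e) 0
    rw [AddCircle.coe_eq_zero_iff] at h0
    obtain ⟨n, hn⟩ := h0
    have h1 : (3 * n : ℝ) = 1 := by
      simp only [zsmul_eq_mul, pow_zero, mul_one] at hn
      rw [hn]; norm_num
    have h2 : 3 * n = 1 := by exact_mod_cast h1
    omega

/-- Distance to zero. -/
noncomputable def rho (y : Sol) : ℝ := ∑' k : ℕ, (1 / 2 : ℝ) ^ k * ‖y.1 k‖

theorem norm_le_half (x : AddCircle (1 : ℝ)) : ‖x‖ ≤ 1 := by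
  have := AddCircle.norm_le_half_period (1 : ℝ) one_ne_zero (x := x)
  simp at this
  linarith

theorem rho_term (y : Sol) (k : ℕ) : ‖(1 / 2 : ℝ) ^ k * ‖y.1 k‖‖ ≤ (1 / 2 : ℝ) ^ k := by
  rw [Real.norm_of_nonneg (by positivity)]
  exact mul_le_of_le_one_right (by positivity) (norm_le_half _)

theorem rho_summable (y : Sol) : Summable fun k : ℕ => (1 / 2 : ℝ) ^ k * ‖y.1 k‖ :=
  Summable.of_norm_bounded summable_geometric_two (rho_term y)

theorem rho_cont : Continuous rho :=
  continuous_tsum (fun k => continuous_const.mul (coord_cont k).norm) summable_geometric_two (fun k y => rho_term y k)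

theorem rho_zero : rho 0 = 0 := by simp [rho]

theorem rho_pos {y : Sol} (hy : y ≠ 0) : 0 < rho y := by
  obtain ⟨k, hk⟩ : ∃ k, y.1 k ≠ 0 := by
    by_contra! hc
    exact hy (Subtype.ext (funext hc))
  have : 0 < (1 / 2 : ℝ) ^ k * ‖y.1 k‖ := by have := norm_pos_iff.2 hk; positivity
  exact this.trans_le ((rho_summable y).le_tsum k fun j _ => by positivity)

theorem rho_io (t : ℝ) : rho (io t) ≤ 2 * |t * √2| := by
  have h1 : ∀ k : ℕ, (1 / 2 : ℝ) ^ k * ‖(io t).1 k‖ ≤ (1 / 2 : ℝ) ^ k * |t * √2| := by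
    intro k
    gcongr
    rw [io_apply]
    refine (QuotientAddGroup.norm_mk_le_norm).trans ?_
    rw [Real.norm_eq_abs, abs_div, abs_of_pos (by positivity : (0 : ℝ) < 2 ^ k)]
    exact div_le_self (abs_nonneg _) (one_le_pow₀ one_le_two)
  have := (rho_summable (io t)).tsum_le_tsum h1 (summable_geometric_two.mul_right _)
  rw [tsum_mul_right, tsum_geometric_two] at this
  exact this

/-- Signed time coordinate near zero. -/
noncomputable def sg (y : Sol) : ℝ := ‖y.1 0 + ((1 / 4 : ℝ) : AddCircle (1 : ℝ))‖ - 1 / 4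

theorem sg_cont : Continuous sg := 
  ((coord_cont 0).add continuous_const).norm.sub continuous_const

theorem sg_io (t : ℝ) (ht : |t * √2| ≤ 1 / 4) : sg (io t) = t * √2 := by
  rw [abs_le] at ht
  unfold sg
  rw [io_apply, ← AddCircle.coe_add, (AddCircle.norm_coe_eq_abs_iff (1 : ℝ) one_ne_zero).2]
  · rw [abs_of_nonneg] <;> simp <;> linarith
  · simp only [pow_zero, div_one, abs_one]
    rw [abs_le]; constructor <;> linarith

/-- The oscillating function. -/
noncomputable def fo (y : Sol) : ℝ :=
  (projIcc (0 : ℝ) 1 zero_le_one (2 * sg y / rho y) : ℝ) * |Real.sin (rho y)⁻¹|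

theorem fo_range (y : Sol) : fo y ∈ Icc (0 : ℝ) 1 := by
  have h1 := (projIcc (0 : ℝ) 1 zero_le_one (2 * sg y / rho y)).2
  exact ⟨mul_nonneg h1.1 (abs_nonneg _), mul_le_one₀ h1.2 (abs_nonneg _) (Real.abs_sin_le_one _)⟩

theorem fo_cont (y : Sol) (hy : y ≠ 0) : ContinuousAt fo y := by
  have h0 : rho y ≠ 0 := (rho_pos hy).ne'
  have h1 : ContinuousAt rho y := rho_cont.continuousAt
  have h2 : ContinuousAt sg y := sg_cont.continuousAt
  have h3 : Continuous fun r : ℝ => (projIcc (0 : ℝ) 1 zero_le_one r : ℝ) := by fun_prop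
  refine ContinuousAt.mul ?_ ?_
  · exact h3.continuousAt.comp ((h2.const_mul 2).div h1 h0)
  · exact (Real.continuous_sin.abs.continuousAt).comp (h1.inv₀ h0)

theorem fo_left : Tendsto (fun t => fo (io t)) (𝓝[<] 0) (𝓝 0) := by
  refine tendsto_const_nhds.congr' ?_
  have h1 : Ioo (-(1 / 8) : ℝ) 0 ∈ 𝓝[<] (0 : ℝ) := Ioo_mem_nhdsLT (by norm_num)
  filter_upwards [h1] with t ht
  have h2 : √2 ≤ 2 := by rw [Real.sqrt_le_left] <;> norm_num
  have h3 : 0 < √2 := by positivity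
  have hlt : t * √2 < 0 := mul_neg_of_neg_of_pos ht.2 h3
  have hs : sg (io t) = t * √2 := by
    refine sg_io t ?_
    rw [abs_of_neg hlt]
    nlinarith [ht.1, ht.2]
  have hr : 0 ≤ rho (io t) := tsum_nonneg fun k => by positivity
  have h4 : 2 * sg (io t) / rho (io t) ≤ 0 := by
    rw [hs]; exact div_nonpos_of_nonpos_of_nonneg (by linarith) hr
  unfold fo
  rw [projIcc_of_le_left _ h4]
  simp

theorem fo_osc (ε : ℝ) (hε : ε > 0) (v : ℝ) (hv : v ∈ Icc (0 : ℝ) 1) :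
    ∃ t ∈ Ioo (0 : ℝ) ε, fo (io t) = v := by
  have h2 : √2 ≤ 2 := by rw [Real.sqrt_le_left] <;> norm_num
  have h3 : 0 < √2 := by positivity
  set e : ℝ := min ε (1 / 8) / 2 with he
  have hmin : 0 < min ε (1 / 8 : ℝ) := lt_min hε (by norm_num)
  have he0 : 0 < e := by positivity
  have heε : e < ε := by have := min_le_left ε (1 / 8 : ℝ); linarith
  have he8 : e < 1 / 8 := by have := min_le_right ε (1 / 8 : ℝ); linarith
  have hio : ∀ t : ℝ, t ≠ 0 → io t ≠ 0 := fun t ht e => ht (io_inj (e.trans (map_zero io).symm))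
  have hr1 : 0 < rho (io e) := rho_pos (hio e he0.ne')
  obtain ⟨n, hn⟩ := exists_nat_gt ((rho (io e))⁻¹)
  set a : ℝ := Real.arcsin v + n * (2 * Real.pi) with ha
  have hpi := Real.pi_gt_three
  have harc : 0 ≤ Real.arcsin v := Real.arcsin_nonneg.2 hv.1
  have hage : (rho (io e))⁻¹ < a := by
    have : (n : ℝ) ≤ n * (2 * Real.pi) := le_mul_of_one_le_right (Nat.cast_nonneg n) (by linarith)
    linarith
  have ha0 : 0 < a := (inv_pos.2 hr1).trans hage
  have hsin : Real.sin a = v := by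
    rw [ha, Real.sin_add_nat_mul_two_pi, Real.sin_arcsin (by linarith [hv.1]) hv.2]
  have hmem : a⁻¹ ∈ Icc (rho (io 0)) (rho (io e)) := by
    rw [map_zero, rho_zero]
    exact ⟨(inv_pos.2 ha0).le, (inv_lt_of_inv_lt₀ hr1 hage).le⟩
  obtain ⟨t, ht, hte⟩ := intermediate_value_Icc he0.le
    (rho_cont.comp io_cont).continuousOn hmem
  simp only [Function.comp] at hte
  have ht0 : t ≠ 0 := by
    rintro rfl
    rw [map_zero, rho_zero] at hte
    exact (inv_pos.2 ha0).ne hte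
  have htp : 0 < t := lt_of_le_of_ne ht.1 ht0.symm
  refine ⟨t, ⟨htp, ht.2.trans_lt heε⟩, ?_⟩
  have hpos : 0 < t * √2 := by positivity
  have hs : sg (io t) = t * √2 := by
    refine sg_io t ?_
    rw [abs_of_pos hpos]
    nlinarith [ht.2]
  have hge : 1 ≤ 2 * sg (io t) / rho (io t) := by
    rw [le_div_iff₀ (rho_pos (hio t ht0)), hs, one_mul]
    have := rho_io t
    rwa [abs_of_pos hpos] at this
  unfold fo
  rw [projIcc_of_right_le _ hge, hte, inv_inv, hsin, abs_of_nonneg hv.1]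
  simp

theorem good : Good io fo where
  cont := io_cont
  inj := io_inj
  lift := io_lift
  dense := io_dense
  off := io_off
  fcont := fo_cont
  frange := fo_range
  fleft := fo_left
  fosc := fo_osc

end solenoid

end Slovak

/-- There exists a non-degenerate continuum admitting a minimal homeomorphism in which every
continuous surjection is either a minimal homeomorphism or has a fixed point. -/
theorem exists_continuum_surjections_dichotomy :
    ∃ (X : Type) (_ : MetricSpace X), CompactSpace X ∧ ConnectedSpace X ∧ Nonempty X ∧
      Nontrivial X ∧
      (∃ T : X ≃ₜ X, IsMinimal ⇑T) ∧
      ∀ φ : X → X, Continuous φ → Function.Surjective φ →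
        (IsHomeomorph φ ∧ IsMinimal φ) ∨ ∃ x : X, φ x = x := by
  have hg := Slovak.good
  have hm1 : TopologicalSpace.MetrizableSpace (ℤ → ℝ) := UniformSpace.metrizableSpace
  have hm2 : TopologicalSpace.MetrizableSpace (Slovak.XS Slovak.io Slovak.fo) := inferInstance
  let m : MetricSpace (Slovak.XS Slovak.io Slovak.fo) := TopologicalSpace.metrizableSpaceMetric _
  refine ⟨Slovak.XS Slovak.io Slovak.fo, m, isCompact_iff_compactSpace.1 (Slovak.isCompact_XS hg),
    Slovak.connected_XS hg, ⟨Slovak.G hg 0⟩, ?_, ⟨Slovak.SH _ _ 1, Slovak.minimal_S hg 1 one_ne_zero⟩, ?_⟩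
  · obtain ⟨y, hy⟩ := hg.off
    refine ⟨Slovak.G hg y, Slovak.G hg (Slovak.io 0), fun e => hy 0 ?_⟩
    rw [← Slovak.G_fst hg y, e]; rfl
  · intro φ hφ hs
    exact Slovak.dichotomy hg φ hφ hs
end
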